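/- arXiv:1510.08132 — 4 statements merged into one kernel-verified Lean document; each statement's English description precedes it below -/
import Mathlib

section
/- Let T be a bounded linear operator on a complex Hilbert space H with numerical radius w(T) ≤ 1 and with spectrum contained in the open unit disk, and let B be a finite Blaschke product with B(0) = 0. Then w(B(T)) ≤ 1, where B(T) is defined via the holomorphic functional calculus (equivalently, by the rational expression for B). -/
open scoped InnerProductSpace

open Polynomial in
lemma aux_prod_lt {ι : Type*} (s : Finset ι) (hs : s.Nonempty) (f g : ι → ℝ)
    (hf : ∀ i ∈ s, 0 ≤ f i) (hfg : ∀ i ∈ s, f i < g i) : ∏ i ∈ s, f i < ∏ i ∈ s, g i := by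
  classical
  induction hs using Finset.Nonempty.cons_induction with
  | singleton i => simpa using hfg i (by simp)
  | cons i t hi ht ih =>
    rw [Finset.prod_cons, Finset.prod_cons]
    have h1 := ih (fun j hj => hf j (by simp [hj])) (fun j hj => hfg j (by simp [hj]))
    have h2 : 0 ≤ ∏ j ∈ t, f j := Finset.prod_nonneg (fun j hj => hf j (by simp [hj]))
    exact mul_lt_mul'' (hfg i (by simp)) h1 (hf i (by simp)) h2

lemma aux_normSq (a z : ℂ) : ‖1 - (starRingEnd ℂ) a * z‖ ^ 2 - ‖a - z‖ ^ 2
    = (1 - ‖a‖ ^ 2) * (1 - ‖z‖ ^ 2) := by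
  simp only [← Complex.normSq_eq_norm_sq, Complex.normSq_apply]
  simp
  ring

open Polynomial in
noncomputable def auxQ {n : ℕ} (a : Fin n → ℂ) : ℂ[X] := ∏ k, (1 - C ((starRingEnd ℂ) (a k)) * X)

open Polynomial in
noncomputable def auxP {n : ℕ} (a : Fin n → ℂ) : ℂ[X] := ∏ k, (C (a k) - X)

open Polynomial in
lemma aux_circle {n : ℕ} (a : Fin n → ℂ) (ha : ∀ k, ‖a k‖ < 1) (hn : 0 < n) (z : ℂ)
    (h : ‖(auxQ a).eval z‖ = ‖(auxP a).eval z‖) : ‖z‖ = 1 := by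
  have hne : (Finset.univ : Finset (Fin n)).Nonempty := ⟨⟨0, hn⟩, by simp⟩
  simp only [auxQ, auxP, eval_prod, norm_prod] at h
  simp at h
  have hk : ∀ k, 0 < 1 - ‖a k‖ ^ 2 := fun k => by
    have := ha k; have := norm_nonneg (a k); nlinarith
  rcases lt_trichotomy ‖z‖ 1 with h1 | h1 | h1
  · exfalso
    refine absurd h (ne_of_gt (aux_prod_lt _ hne _ _ (fun i _ => norm_nonneg _) fun k _ => ?_))
    have h3 := aux_normSq (a k) z
    have h4 : 0 < 1 - ‖z‖ ^ 2 := by have := norm_nonneg z; nlinarith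
    have h5 := mul_pos (hk k) h4
    exact lt_of_pow_lt_pow_left₀ 2 (norm_nonneg _) (by linarith)
  · exact h1
  · exfalso
    refine absurd h (ne_of_lt (aux_prod_lt _ hne _ _ (fun i _ => norm_nonneg _) fun k _ => ?_))
    have h3 := aux_normSq (a k) z
    have h4 : 0 < ‖z‖ ^ 2 - 1 := by nlinarith
    have h5 := mul_pos (hk k) h4
    exact lt_of_pow_lt_pow_left₀ 2 (norm_nonneg _) (by nlinarith)

open Polynomial in
lemma aux_logder {ι : Type*} (s : Finset ι) (f : ι → ℂ[X]) (z : ℂ)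
    (h : ∀ i ∈ s, (f i).eval z ≠ 0) :
    (derivative (∏ i ∈ s, f i)).eval z
      = (∏ i ∈ s, f i).eval z * ∑ i ∈ s, (derivative (f i)).eval z / (f i).eval z := by
  classical
  induction s using Finset.cons_induction with
  | empty => simp
  | cons i t hi ih =>
    have h1 := ih (fun j hj => h j (by simp [hj]))
    have h2 := h i (by simp)
    rw [Finset.prod_cons, Finset.sum_cons, derivative_mul, eval_add, eval_mul, eval_mul, h1,
      eval_mul]
    field_simp

lemma aux_term (a z : ℂ) (ha : ‖a‖ < 1) (hz : ‖z‖ = 1) :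
    ∃ r : ℝ, 0 < r ∧ -z * (-(starRingEnd ℂ) a / (1 - (starRingEnd ℂ) a * z) - (-1) / (a - z)) = r := by
  have h1 : 1 - (starRingEnd ℂ) a * z ≠ 0 := by
    intro h
    have : ‖(starRingEnd ℂ) a * z‖ = 1 := by rw [← sub_eq_zero.mp h]; simp
    simp [hz] at this; linarith
  have h2 : a - z ≠ 0 := by
    intro h
    rw [sub_eq_zero.mp h] at ha; linarith
  have hzz : z * (starRingEnd ℂ) z = 1 := by
    rw [Complex.mul_conj, Complex.normSq_eq_norm_sq, hz]; simp
  have haa : a * (starRingEnd ℂ) a = ((‖a‖ ^ 2 : ℝ) : ℂ) := by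
    rw [Complex.mul_conj, Complex.normSq_eq_norm_sq]
  refine ⟨(1 - ‖a‖ ^ 2) / ‖a - z‖ ^ 2, ?_, ?_⟩
  · have := norm_nonneg a
    have : 0 < ‖a - z‖ := norm_pos_iff.mpr h2
    have : 0 < 1 - ‖a‖ ^ 2 := by nlinarith
    positivity
  · have h3 : ((‖a - z‖ ^ 2 : ℝ) : ℂ) = (a - z) * ((starRingEnd ℂ) a - (starRingEnd ℂ) z) := by
      rw [← map_sub, Complex.mul_conj, Complex.normSq_eq_norm_sq]
    have h4 : (starRingEnd ℂ) a - (starRingEnd ℂ) z ≠ 0 := by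
      rw [← map_sub]; exact (map_ne_zero _).mpr h2
    rw [Complex.ofReal_div, h3, Complex.ofReal_sub, ← haa]
    rw [div_sub_div _ _ h1 h2, mul_div_assoc', div_eq_div_iff (mul_ne_zero h1 h2) (mul_ne_zero h2 h4)]
    push_cast
    set b := (starRingEnd ℂ) a
    set w := (starRingEnd ℂ) z
    linear_combination (a - z) * (1 - a * b) * hzz

open Polynomial in
lemma aux_deriv {n : ℕ} (a : Fin n → ℂ) (ha : ∀ k, ‖a k‖ < 1) (hn : 0 < n) (z v : ℂ)
    (hz : ‖z‖ = 1) (h : (auxQ a - C v * auxP a).eval z = 0) :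
    ∃ r : ℝ, 0 < r ∧ -z * (derivative (auxQ a - C v * auxP a)).eval z = r * (auxQ a).eval z ∧
      (auxQ a).eval z ≠ 0 := by
  have h1 : ∀ k, 1 - (starRingEnd ℂ) (a k) * z ≠ 0 := by
    intro k h
    have : ‖(starRingEnd ℂ) (a k) * z‖ = 1 := by rw [← sub_eq_zero.mp h]; simp
    have := ha k
    simp [hz] at *; linarith
  have h2 : ∀ k, a k - z ≠ 0 := by
    intro k h
    have := ha k
    rw [sub_eq_zero.mp h] at this; linarith
  choose r hr hr' using fun k => aux_term (a k) z (ha k) hz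
  have hne : (Finset.univ : Finset (Fin n)).Nonempty := ⟨⟨0, hn⟩, by simp⟩
  refine ⟨∑ k, r k, Finset.sum_pos (fun k _ => hr k) hne, ?_, ?_⟩
  · have hQ : (derivative (auxQ a)).eval z = (auxQ a).eval z *
        ∑ k, -(starRingEnd ℂ) (a k) / (1 - (starRingEnd ℂ) (a k) * z) := by
      unfold auxQ
      rw [aux_logder _ _ _ (fun k _ => by simpa using h1 k)]
      simp
    have hP : (derivative (auxP a)).eval z = (auxP a).eval z *
        ∑ k, (-1) / (a k - z) := by
      unfold auxP
      rw [aux_logder _ _ _ (fun k _ => by simpa using h2 k)]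
      simp
    have h' : v * (auxP a).eval z = (auxQ a).eval z := by
      simp at h; linear_combination -h
    rw [derivative_sub, derivative_C_mul, eval_sub, eval_mul, eval_C, hQ, hP, ← mul_assoc v, h',
      Complex.ofReal_sum, ← Finset.sum_congr rfl (fun k _ => hr' k), ← Finset.mul_sum,
      Finset.sum_sub_distrib]
    ring
  · rw [auxQ, eval_prod, Finset.prod_ne_zero_iff]
    intro k _
    simpa using h1 k

open Polynomial in
lemma aux_deg {n : ℕ} (a : Fin n → ℂ) (h0 : ∃ k, a k = 0) (v : ℂ) (hv : v ≠ 0) :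
    (auxQ a).degree < n ∧ (auxQ a - C v * auxP a).degree = n := by
  obtain ⟨j, hj⟩ := h0
  have hQ : (auxQ a).degree < n := by
    have h1 : auxQ a = ∏ k ∈ Finset.univ.erase j, (1 - C ((starRingEnd ℂ) (a k)) * X) := by
      rw [auxQ, ← Finset.mul_prod_erase _ _ (Finset.mem_univ j)]; simp [hj]
    have h2 : (auxQ a).natDegree ≤ ∑ k ∈ Finset.univ.erase j, 1 := by
      rw [h1]
      refine (natDegree_prod_le _ _).trans (Finset.sum_le_sum fun k _ => ?_)
      compute_degree
    have hn : 0 < n := j.pos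
    simp at h2
    refine lt_of_le_of_lt degree_le_natDegree ?_
    exact_mod_cast (show (auxQ a).natDegree < n by omega)
  refine ⟨hQ, ?_⟩
  have hP : (C v * auxP a).degree = n := by
    rw [degree_C_mul hv, auxP, degree_prod]
    have : ∀ k, (C (a k) - X).degree = 1 := fun k => by
      rw [← neg_sub, degree_neg, degree_X_sub_C]
    simp [this]
  rw [degree_sub_eq_right_of_degree_lt (by rw [hP]; exact hQ), hP]

open Polynomial in
lemma aux_key {n : ℕ} (a : Fin n → ℂ) (ha : ∀ k, ‖a k‖ < 1) (h0 : ∃ k, a k = 0) (v : ℂ)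
    (hv : ‖v‖ = 1) :
    ∃ (s : Finset ℂ) (d : ℂ → ℝ) (S : ℂ → ℂ[X]),
      (∀ z ∈ s, ‖z‖ = 1 ∧ 0 ≤ d z ∧
        auxQ a - C v * auxP a = C (-z) * ((1 - C ((starRingEnd ℂ) z) * X) * S z)) ∧
      auxQ a = ∑ z ∈ s, C ((d z : ℂ) * (-z)) * S z := by
  classical
  have hv0 : v ≠ 0 := by rintro rfl; simp at hv
  have hn : 0 < n := h0.choose.pos
  obtain ⟨hdQ, hdR⟩ := aux_deg a h0 v hv0
  set R := auxQ a - C v * auxP a with hR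
  have hR0 : R ≠ 0 := by
    rintro h; rw [h] at hdR; simp at hdR
  have hcirc : ∀ z ∈ R.roots, ‖z‖ = 1 := by
    intro z hz
    have h1 : R.eval z = 0 := (mem_roots hR0).mp hz
    refine aux_circle a ha hn z ?_
    rw [hR] at h1
    simp only [eval_sub, eval_mul, eval_C] at h1
    rw [sub_eq_zero.mp h1, norm_mul, hv, one_mul]
  have hder : ∀ z ∈ R.roots, ∃ r : ℝ, 0 < r ∧
      -z * (derivative R).eval z = r * (auxQ a).eval z ∧ (auxQ a).eval z ≠ 0 := fun z hz =>
    aux_deriv a ha hn z v (hcirc z hz) ((mem_roots hR0).mp hz)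
  have hnod : R.roots.Nodup := by
    rw [Multiset.nodup_iff_count_le_one]
    intro z
    rw [count_roots]
    by_contra hlt
    push Not at hlt
    rw [one_lt_rootMultiplicity_iff_isRoot hR0] at hlt
    obtain ⟨r, hr, h1, h2⟩ := hder z ((mem_roots hR0).mpr hlt.1)
    have h3 : (derivative R).eval z = 0 := hlt.2
    rw [h3, mul_zero] at h1
    have : (r : ℂ) ≠ 0 := by exact_mod_cast hr.ne'
    exact mul_ne_zero this h2 h1.symm
  have hcard : R.roots.toFinset.card = n := by
    rw [Multiset.toFinset_card_of_nodup hnod]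
    have h1 : R.roots.card = R.natDegree := (IsAlgClosed.splits R).natDegree_eq_card_roots.symm
    rw [h1]
    exact natDegree_eq_of_degree_eq_some hdR
  choose! r hr hr1 hr2 using hder
  have hS : ∀ z ∈ R.roots, (X - C z) * (R /ₘ (X - C z)) = R := fun z hz =>
    mul_divByMonic_eq_iff_isRoot.mpr ((mem_roots hR0).mp hz)
  have hzz : ∀ z ∈ R.roots, z * (starRingEnd ℂ) z = 1 := fun z hz => by
    rw [Complex.mul_conj, Complex.normSq_eq_norm_sq, hcirc z hz]; simp
  refine ⟨R.roots.toFinset, fun z => (r z)⁻¹, fun z => R /ₘ (X - C z), ?_, ?_⟩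
  · intro z hz
    rw [Multiset.mem_toFinset] at hz
    refine ⟨hcirc z hz, (inv_pos.mpr (hr z hz)).le, ?_⟩
    conv_lhs => rw [← hS z hz]
    rw [← mul_assoc]
    congr 1
    have : C z * C ((starRingEnd ℂ) z) = (1 : ℂ[X]) := by rw [← C_mul, hzz z hz, C_1]
    rw [C_neg]
    linear_combination -X * this
  · refine eq_of_degrees_lt_of_eval_finset_eq R.roots.toFinset ?_ ?_ ?_
    · rw [hcard]; exact hdQ
    · rw [hcard]
      refine lt_of_le_of_lt (degree_sum_le _ _) ?_
      rw [Finset.sup_lt_iff (by exact WithBot.bot_lt_coe n)]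
      intro z hz
      rw [← smul_eq_C_mul]
      refine lt_of_le_of_lt (degree_smul_le _ _) ?_
      rw [← hdR]
      exact degree_divByMonic_lt R (X - C z) hR0 (by rw [degree_X_sub_C]; norm_num)
    · intro z hz
      rw [Multiset.mem_toFinset] at hz
      rw [eval_finset_sum, Finset.sum_eq_single z]
      · have h1 : (R /ₘ (X - C z)).eval z = (derivative R).eval z := by
          conv_rhs => rw [← hS z hz]
          simp
        rw [eval_mul, eval_C, h1, mul_assoc, hr1 z hz, ← mul_assoc]
        have : (r z : ℂ) ≠ 0 := by exact_mod_cast (hr z hz).ne'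
        push_cast
        rw [inv_mul_cancel₀ this, one_mul]
      · intro w hw hwz
        rw [Multiset.mem_toFinset] at hw
        have h1 : R.eval z = 0 := (mem_roots hR0).mp hz
        rw [← hS w hw] at h1
        simp only [eval_mul, eval_sub, eval_X, eval_C, mul_eq_zero] at h1
        rcases h1 with h1 | h1
        · exact absurd (sub_eq_zero.mp h1).symm hwz
        · rw [eval_mul, h1, mul_zero]
      · intro h; exact absurd (Multiset.mem_toFinset.mpr hz) h

open Polynomial in
lemma aux_comm {A : Type*} [Ring A] [Algebra ℂ A] (T : A) :
    ∀ (n : ℕ) (a : Fin n → ℂ)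
      (_ : ∀ k, IsUnit (1 - (starRingEnd ℂ) (a k) • T)),
      (List.ofFn fun k : Fin n => ((a k) • (1 : A) - T) *
          Ring.inverse (1 - (starRingEnd ℂ) (a k) • T)).prod * aeval T (auxQ a)
        = aeval T (auxP a) ∧ IsUnit (aeval T (auxQ a)) := by
  intro n
  induction n with
  | zero => intro a _; simp [auxQ, auxP]
  | succ n ih =>
    intro a hu
    obtain ⟨h1, h2⟩ := ih (fun k => a k.succ) (fun k => hu k.succ)
    have hD : aeval T (1 - C ((starRingEnd ℂ) (a 0)) * X) = 1 - (starRingEnd ℂ) (a 0) • T := by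
      simp [Algebra.smul_def]
    have hA : aeval T (C (a 0) - X) = a 0 • (1 : A) - T := by
      simp [Algebra.smul_def]
    have hQ : auxQ a = auxQ (fun k : Fin n => a k.succ) * (1 - C ((starRingEnd ℂ) (a 0)) * X) := by
      rw [auxQ, Fin.prod_univ_succ, mul_comm]; rfl
    have hP : auxP a = (C (a 0) - X) * auxP (fun k : Fin n => a k.succ) := by
      rw [auxP, Fin.prod_univ_succ]; rfl
    have hu0 := hu 0
    constructor
    · rw [List.ofFn_succ, List.prod_cons, hQ, hP, map_mul, map_mul, hA]
      rw [mul_assoc, ← mul_assoc (List.prod _), h1, ← map_mul,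
        mul_comm (auxP _), map_mul, hD, mul_assoc, ← mul_assoc (Ring.inverse _),
        Ring.inverse_mul_cancel _ hu0, one_mul]
    · rw [hQ, map_mul, hD]
      exact h2.mul hu0

open Polynomial in
/-- Berger–Stampfli for finite Blaschke products: if `w(T) ≤ 1`, the spectrum of `T`
lies in the open unit disk, and `B` is a finite Blaschke product with `B(0) = 0`, then
`w(B(T)) ≤ 1`, where `B(T)` is given by the rational expression for `B`. -/
theorem stmt3 {H : Type*} [NormedAddCommGroup H] [InnerProductSpace ℂ H] [CompleteSpace H]
    (T : H →L[ℂ] H)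
    (hw : ∀ x : H, ‖x‖ = 1 → ‖⟪x, T x⟫_ℂ‖ ≤ 1)
    (hσ : spectrum ℂ T ⊆ Metric.ball 0 1)
    (n : ℕ) (a : Fin n → ℂ) (ha : ∀ k, ‖a k‖ < 1)
    (c : ℂ) (hc : ‖c‖ = 1)
    (hB0 : ∃ k, a k = 0)
    (BT : H →L[ℂ] H)
    (hBT : BT = c • (List.ofFn fun k : Fin n =>
        ((a k) • (1 : H →L[ℂ] H) - T) *
          Ring.inverse ((1 : H →L[ℂ] H) - (starRingEnd ℂ) (a k) • T)).prod) :
    ∀ x : H, ‖x‖ = 1 → ‖⟪x, BT x⟫_ℂ‖ ≤ 1 := by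
  have hw' : ∀ x : H, ‖⟪x, T x⟫_ℂ‖ ≤ ‖x‖ ^ 2 := by
    intro x
    by_cases hx : x = 0
    · simp [hx]
    have hx' : 0 < ‖x‖ := norm_pos_iff.mpr hx
    have h1 := hw (((‖x‖⁻¹ : ℝ) : ℂ) • x) (by
      rw [norm_smul, Complex.norm_real, norm_inv, norm_norm, inv_mul_cancel₀ hx'.ne'])
    rw [map_smul, inner_smul_left, inner_smul_right, norm_mul, norm_mul, Complex.conj_ofReal,
      Complex.norm_real, norm_inv, norm_norm] at h1
    rw [← mul_assoc, ← mul_inv, inv_mul_le_iff₀ (by positivity)] at h1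
    nlinarith
  have hpos : ∀ (z : ℂ), ‖z‖ = 1 → ∀ x : H, 0 ≤ (⟪x, x - z • T x⟫_ℂ).re := by
    intro z hz x
    rw [inner_sub_right, inner_smul_right, inner_self_eq_norm_sq_to_K, Complex.sub_re]
    have h1 := Complex.re_le_norm (z * ⟪x, T x⟫_ℂ)
    rw [norm_mul, hz, one_mul] at h1
    have h2 := hw' x
    have h3 : (((‖x‖ : ℝ) : ℂ) ^ 2).re = ‖x‖ ^ 2 := by
      rw [← Complex.ofReal_pow, Complex.ofReal_re]
    change 0 ≤ (((‖x‖ : ℝ) : ℂ) ^ 2).re - _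
    rw [h3]; linarith
  have hu : ∀ k, IsUnit ((1 : H →L[ℂ] H) - (starRingEnd ℂ) (a k) • T) := by
    intro k
    by_cases hk : (starRingEnd ℂ) (a k) = 0
    · simp [hk]
    set b := (starRingEnd ℂ) (a k) with hb
    have hb1 : ‖b‖ < 1 := by rw [hb, RCLike.norm_conj]; exact ha k
    have h1 : b⁻¹ ∉ spectrum ℂ T := by
      intro h
      have := hσ h
      rw [mem_ball_zero_iff, norm_inv] at this
      exact absurd this (not_lt.mpr ((one_le_inv₀ (norm_pos_iff.mpr hk)).mpr hb1.le))
    rw [spectrum.notMem_iff] at h1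
    have h2 := (IsUnit.mk0 b hk).map (algebraMap ℂ (H →L[ℂ] H)) |>.mul h1
    rw [mul_sub, ← map_mul, mul_inv_cancel₀ hk, map_one, ← Algebra.smul_def] at h2
    exact h2
  obtain ⟨hcomm, hunit⟩ := aux_comm T n a hu
  intro x hx
  obtain ⟨u, hu1, hu2⟩ : ∃ u : ℂ, ‖u‖ = 1 ∧ u * ⟪x, BT x⟫_ℂ = (‖⟪x, BT x⟫_ℂ‖ : ℝ) := by
    set p := ⟪x, BT x⟫_ℂ
    by_cases hp : p = 0
    · exact ⟨1, by simp, by simp [hp]⟩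
    · have : ((‖p‖ : ℝ) : ℂ) ≠ 0 := by simpa using hp
      refine ⟨(‖p‖ : ℝ) / p, ?_, ?_⟩
      · rw [norm_div, Complex.norm_real, norm_norm, div_self (by simpa using hp)]
      · field_simp
  obtain ⟨s, d, S, hs, hQ⟩ := aux_key a ha hB0 (u * c) (by rw [norm_mul, hu1, hc, one_mul])
  obtain ⟨U, hU⟩ := hunit
  set y := (↑U⁻¹ : H →L[ℂ] H) x with hy
  have hxy : aeval T (auxQ a) y = x := by
    rw [hy, ← hU, ← ContinuousLinearMap.mul_apply, Units.mul_inv]; rfl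
  have hBx : u • BT x = aeval T (C (u * c) * auxP a) y := by
    rw [map_mul, ← hcomm, aeval_C, hBT]
    rw [← Algebra.smul_def, ← hxy]
    simp [mul_smul]
  have hR : x - u • BT x = aeval T (auxQ a - C (u * c) * auxP a) y := by
    rw [hBx, map_sub]
    simp [hxy]
  have hmain : 0 ≤ (⟪x, x - u • BT x⟫_ℂ).re := by
    have hx2 : x = ∑ z ∈ s, ((d z : ℂ) * (-z)) • (aeval T (S z)) y := by
      conv_lhs => rw [← hxy, hQ]
      rw [map_sum, ContinuousLinearMap.sum_apply]
      refine Finset.sum_congr rfl fun z _ => ?_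
      rw [map_mul, aeval_C, ← Algebra.smul_def]; rfl
    have e : ⟪x, x - u • BT x⟫_ℂ
        = ∑ z ∈ s, ⟪((d z : ℂ) * (-z)) • (aeval T (S z)) y, x - u • BT x⟫_ℂ := by
      rw [← sum_inner, ← hx2]
    rw [e, Complex.re_sum]
    refine Finset.sum_nonneg fun z hz => ?_
    obtain ⟨hz1, hd, hRz⟩ := hs z hz
    set q := aeval T (S z) y with hq
    have h1 : x - u • BT x = (-z) • (q - (starRingEnd ℂ) z • T q) := by
      rw [hR, hRz, map_mul, aeval_C, ← Algebra.smul_def, map_mul, map_sub, map_one, map_mul,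
        aeval_C, aeval_X, ← Algebra.smul_def]
      rfl
    have hzz : (starRingEnd ℂ) z * z = 1 := by
      rw [mul_comm, Complex.mul_conj, Complex.normSq_eq_norm_sq, hz1]; simp
    rw [h1, inner_smul_left, inner_smul_right, map_mul, Complex.conj_ofReal, map_neg]
    have h2 : ∀ t : ℂ, (d z : ℂ) * -(starRingEnd ℂ) z * (-z * t) = (d z : ℂ) * t := fun t => by
      linear_combination (d z : ℂ) * t * hzz
    rw [h2, Complex.re_ofReal_mul]
    exact mul_nonneg hd (hpos _ (by rw [RCLike.norm_conj]; exact hz1) q)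
  rw [inner_sub_right, inner_smul_right, hu2, inner_self_eq_norm_sq_to_K, hx] at hmain
  simp at hmain
  exact hmain
end

section
/- Let T be a bounded linear operator on a complex Hilbert space H with w(T) ≤ 1, and let f be continuous on the closed unit disk, holomorphic on the open unit disk, with f(0) = 0. Then f(T) := lim_{r→1⁻} f(rT) exists in operator norm and w(f(T)) ≤ sup_{|z|≤1} |f(z)|. (Berger–Stampfli theorem.) -/
open scoped InnerProductSpace

namespace BS
open Metric Real

set_option linter.unusedSectionVars false
set_option linter.unusedSimpArgs false

variable {H : Type*} [NormedAddCommGroup H] [InnerProductSpace ℂ H] [CompleteSpace H]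

/-- The resolvent-type function `(1 - zS)⁻¹`. -/
noncomputable def res (S : H →L[ℂ] H) (z : ℂ) : H →L[ℂ] H := Ring.inverse (1 - z • S)

/-- Functional calculus as a circle average. -/
noncomputable def Phi (S : H →L[ℂ] H) (h : ℂ → ℂ) : H →L[ℂ] H :=
  circleAverage (fun z => h z • res S z⁻¹) 0 1

/-- Numerical radius bounded by `r`. -/
def NR (S : H →L[ℂ] H) (r : ℝ) : Prop := ∀ x, ‖⟪x, S x⟫_ℂ‖ ≤ r * ‖x‖ ^ 2

lemma NR.star {S : H →L[ℂ] H} {r : ℝ} (h : NR S r) : NR (star S) r := by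
  intro x
  rw [ContinuousLinearMap.star_eq_adjoint, ContinuousLinearMap.adjoint_inner_right,
    ← inner_conj_symm, RCLike.norm_conj]
  exact h x

lemma NR.re_ge {S : H →L[ℂ] H} {r : ℝ} (h : NR S r) {z : ℂ} (hz : ‖z‖ ≤ 1) (x : H) :
    (1 - r) * ‖x‖ ^ 2 ≤ (⟪x, (1 - z • S) x⟫_ℂ).re := by
  have h1 : ⟪x, (1 - z • S) x⟫_ℂ = (‖x‖ ^ 2 : ℝ) - z * ⟪x, S x⟫_ℂ := by
    simp [inner_sub_right, inner_smul_right, inner_self_eq_norm_sq_to_K]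
  rw [h1, Complex.sub_re, Complex.ofReal_re]
  have h2 := (Complex.re_le_norm (z * ⟪x, S x⟫_ℂ))
  rw [norm_mul] at h2
  have h3 : ‖z‖ * ‖⟪x, S x⟫_ℂ‖ ≤ 1 * ‖⟪x, S x⟫_ℂ‖ := by gcongr
  linarith [h x]

lemma NR.isUnit {S : H →L[ℂ] H} {r : ℝ} (h : NR S r) (hr : r < 1) {z : ℂ} (hz : ‖z‖ ≤ 1) :
    IsUnit (1 - z • S) := by
  refine ContinuousLinearMap.isUnit_of_forall_le_norm_inner_map _ (c := Real.toNNReal (1 - r))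
    (by simpa using hr) fun x => ?_
  have := h.re_ge hz x
  rw [norm_inner_symm, Real.coe_toNNReal _ (by linarith)]
  have h2 := Complex.re_le_norm ⟪x, (1 - z • S) x⟫_ℂ
  linarith

lemma NR.re_res {S : H →L[ℂ] H} {r : ℝ} (h : NR S r) (hr : r < 1) {z : ℂ} (hz : ‖z‖ ≤ 1) (x : H) :
    0 ≤ (⟪x, res S z x⟫_ℂ).re := by
  have h1 : (1 - z • S) (res S z x) = x := by
    have := Ring.mul_inverse_cancel _ (h.isUnit hr hz)
    exact congrArg (fun A : H →L[ℂ] H => A x) this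
  have h2 := h.re_ge hz (res S z x)
  rw [h1, ← inner_conj_symm, Complex.conj_re] at h2
  refine le_trans ?_ h2
  have : 0 ≤ 1 - r := by linarith
  positivity

lemma res_star (S : H →L[ℂ] H) (z : ℂ) : res (star S) (star z) = star (res S z) := by
  rw [res, res, ← Ring.inverse_star]
  simp

lemma NR.diff {S : H →L[ℂ] H} {r : ℝ} (h : NR S r) (hr : r < 1) {z : ℂ} (hz : ‖z‖ ≤ 1) :
    DifferentiableAt ℂ (res S) z := by
  unfold res
  have := differentiableAt_inverse (𝕜 := ℂ) (h.isUnit hr hz)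
  exact DifferentiableAt.comp (f := fun z : ℂ => (1 : H →L[ℂ] H) - z • S) z this
    ((differentiableAt_const _).sub (differentiableAt_id.smul_const S))

lemma NR.cont {S : H →L[ℂ] H} {r : ℝ} (h : NR S r) (hr : r < 1) :
    ContinuousOn (fun z : ℂ => res S z⁻¹) (sphere 0 1) := by
  intro z hz
  have hz1 : ‖z‖ = 1 := by simpa using hz
  have hz0 : z ≠ 0 := by rintro rfl; simp at hz1
  refine ContinuousAt.continuousWithinAt ?_
  exact ContinuousAt.comp (f := fun z : ℂ => z⁻¹) (g := res S)
    (h.diff hr (by simp [hz1])).continuousAt (continuousAt_inv₀ hz0)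

lemma NR.avg {S : H →L[ℂ] H} {r : ℝ} (h : NR S r) (hr : r < 1) {f : ℂ → ℂ}
    (hf : DiffContOnCl ℂ f (ball 0 1)) :
    circleAverage (fun z => f z • res S z) 0 1 = f 0 • (1 : H →L[ℂ] H) := by
  have hd : DiffContOnCl ℂ (res S) (ball 0 1) := by
    refine DifferentiableOn.diffContOnCl fun z hz => ?_
    rw [closure_ball _ one_ne_zero] at hz
    exact (h.diff hr (by simpa using hz)).differentiableWithinAt
  have := (DiffContOnCl.smul hf hd)
  have h2 := DiffContOnCl.circleAverage (c := 0) (R := 1) (f := fun z => f z • res S z)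
    (by simpa using this)
  rw [h2]
  simp [res]

lemma contOn {f : ℂ → ℂ} (hf : DiffContOnCl ℂ f (ball 0 1)) : ContinuousOn f (sphere 0 1) :=
  hf.continuousOn_ball.mono sphere_subset_closedBall

lemma NR.integrable {S : H →L[ℂ] H} {r : ℝ} (h : NR S r) (hr : r < 1) {f : ℂ → ℂ}
    (hf : ContinuousOn f (sphere 0 1)) :
    CircleIntegrable (fun z => f z • res S z⁻¹) 0 1 :=
  (hf.smul (h.cont hr)).circleIntegrable zero_le_one

lemma Phi_one {S : H →L[ℂ] H} {r : ℝ} (h : NR S r) (hr : r < 1) : Phi S (fun _ => 1) = 1 := by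
  have := h.avg hr (f := fun _ => 1) diffContOnCl_const
  rw [Phi, ← circleAverage_zero_one_congr_inv]
  simpa using this

lemma Phi_mul_S {S : H →L[ℂ] H} {r : ℝ} (h : NR S r) (hr : r < 1) {f : ℂ → ℂ}
    (hf : DiffContOnCl ℂ f (ball 0 1)) : Phi S f * S = Phi S (fun z => z * f z) := by
  have hid : DiffContOnCl ℂ (fun z : ℂ => z) (ball 0 1) := differentiable_id.diffContOnCl
  have hzf : DiffContOnCl ℂ (fun z : ℂ => z * f z) (ball 0 1) := hid.smul hf
  have h0 : circleAverage (fun z => (z * f z) • (1 : H →L[ℂ] H)) 0 1 = 0 := by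
    have := DiffContOnCl.circleAverage (c := 0) (R := 1)
      (f := fun z => (z * f z) • (1 : H →L[ℂ] H))
      (by simpa using hzf.smul (diffContOnCl_const (c := (1 : H →L[ℂ] H))))
    rw [this]; simp
  let L : (H →L[ℂ] H) →L[ℝ] (H →L[ℂ] H) :=
    ((ContinuousLinearMap.mul ℂ (H →L[ℂ] H)).flip S).restrictScalars ℝ
  have h1 : Phi S f * S = circleAverage (fun z => f z • res S z⁻¹ * S) 0 1 :=
    (L.circleAverage_comp_comm (h.integrable hr (contOn hf))).symm
  rw [h1, Phi]
  have h2 : CircleIntegrable (fun z => (z * f z) • (1 : H →L[ℂ] H)) 0 1 :=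
    ((contOn hzf).smul continuousOn_const).circleIntegrable zero_le_one
  rw [← sub_zero (circleAverage (fun z => (z * f z) • res S z⁻¹) 0 1), ← h0,
    ← circleAverage_fun_sub (h.integrable hr (contOn hzf)) h2]
  refine circleAverage_congr_sphere fun z hz => ?_
  have hz1 : ‖z‖ = 1 := by simpa using hz
  have hz0 : z ≠ 0 := by rintro rfl; simp at hz1
  have h3 : res S z⁻¹ * (1 - z⁻¹ • S) = 1 :=
    Ring.inverse_mul_cancel _ (h.isUnit hr (by simp [hz1]))
  have h4 : res S z⁻¹ * S = z • (res S z⁻¹ - 1) := by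
    rw [mul_sub, mul_one, mul_smul_comm] at h3
    rw [← h3, sub_sub_cancel, smul_inv_smul₀ hz0]
  simp only [smul_mul_assoc, h4, smul_sub, smul_smul]
  rw [mul_comm z]

lemma Phi_add {S : H →L[ℂ] H} {r : ℝ} (h : NR S r) (hr : r < 1) {f g : ℂ → ℂ}
    (hf : ContinuousOn f (sphere 0 1)) (hg : ContinuousOn g (sphere 0 1)) :
    Phi S (fun z => f z + g z) = Phi S f + Phi S g := by
  simp only [Phi, add_smul]
  exact circleAverage_fun_add (h.integrable hr hf) (h.integrable hr hg)

lemma Phi_sub {S : H →L[ℂ] H} {r : ℝ} (h : NR S r) (hr : r < 1) {f g : ℂ → ℂ}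
    (hf : ContinuousOn f (sphere 0 1)) (hg : ContinuousOn g (sphere 0 1)) :
    Phi S (fun z => f z - g z) = Phi S f - Phi S g := by
  simp only [Phi, sub_smul]
  exact circleAverage_fun_sub (h.integrable hr hf) (h.integrable hr hg)

lemma Phi_smul (S : H →L[ℂ] H) (c : ℂ) (f : ℂ → ℂ) :
    Phi S (fun z => c * f z) = c • Phi S f := by
  simp only [Phi, mul_smul]
  exact circleAverage_fun_smul

lemma poly_da (p : Polynomial ℂ) : DiffContOnCl ℂ (fun z => p.eval z) (ball 0 1) :=
  p.differentiable.diffContOnCl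

lemma Phi_mul_poly {S : H →L[ℂ] H} {r : ℝ} (h : NR S r) (hr : r < 1) {f : ℂ → ℂ}
    (hf : DiffContOnCl ℂ f (ball 0 1)) (p : Polynomial ℂ) :
    Phi S f * Polynomial.aeval S p = Phi S (fun z => p.eval z * f z) := by
  induction p using Polynomial.induction_on with
  | C a => simp [Phi_smul, Algebra.algebraMap_eq_smul_one]
  | add p q hp hq =>
    have e := fun p : Polynomial ℂ => contOn ((poly_da p).smul hf)
    simp only [map_add, mul_add, hp, hq, Polynomial.eval_add, add_mul]
    exact (Phi_add h hr (e p) (e q)).symm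
  | monomial n a ih =>
    have e : DiffContOnCl ℂ (fun z => (Polynomial.C a * Polynomial.X ^ n).eval z * f z) (ball 0 1) :=
      (poly_da _).smul hf
    have h1 : Polynomial.aeval S (Polynomial.C a * Polynomial.X ^ (n + 1))
        = Polynomial.aeval S (Polynomial.C a * Polynomial.X ^ n) * S := by
      simp [pow_succ, mul_assoc]
    rw [h1, ← mul_assoc, ih, Phi_mul_S h hr e]
    congr 1; ext z; simp; ring

lemma Phi_poly {S : H →L[ℂ] H} {r : ℝ} (h : NR S r) (hr : r < 1) (p : Polynomial ℂ) :
    Phi S (fun z => p.eval z) = Polynomial.aeval S p := by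
  have := Phi_mul_poly h hr (f := fun _ => 1) diffContOnCl_const p
  rw [Phi_one h hr, one_mul] at this
  simpa using this.symm

/-- Evaluation of the quadratic form as a real-linear functional. -/
noncomputable def ev (x : H) : (H →L[ℂ] H) →L[ℝ] ℂ :=
  ((innerSL ℂ x).comp (ContinuousLinearMap.apply ℂ H x)).restrictScalars ℝ

lemma ev_apply (x : H) (A : H →L[ℂ] H) : ev x A = ⟪x, A x⟫_ℂ := rfl

lemma ev_cont {S : H →L[ℂ] H} {r : ℝ} (h : NR S r) (hr : r < 1) (x : H) :
    ContinuousOn (fun z : ℂ => ⟪x, res S z⁻¹ x⟫_ℂ) (sphere 0 1) :=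
  (ev x).continuous.comp_continuousOn (h.cont hr)

lemma key {S : H →L[ℂ] H} {r : ℝ} (h : NR S r) (hr : r < 1) {f : ℂ → ℂ}
    (hf : DiffContOnCl ℂ f (ball 0 1)) (x : H) :
    ⟪x, Phi S f x⟫_ℂ + f 0 * (‖x‖ ^ 2 : ℝ) =
      circleAverage (fun z => f z * (2 * (⟪x, res S z⁻¹ x⟫_ℂ).re : ℝ)) 0 1 := by
  have h1 : ⟪x, Phi S f x⟫_ℂ = circleAverage (fun z => f z * ⟪x, res S z⁻¹ x⟫_ℂ) 0 1 := by
    rw [← ev_apply, Phi, ← (ev x).circleAverage_comp_comm (h.integrable hr (contOn hf))]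
    congr 1; ext z; simp [ev_apply, inner_smul_right]
  have h2 : f 0 * (‖x‖ ^ 2 : ℝ) =
      circleAverage (fun z => f z * (starRingEnd ℂ) ⟪x, res S z⁻¹ x⟫_ℂ) 0 1 := by
    have hi : CircleIntegrable (fun z => f z • res (star S) z) 0 1 := by
      refine ContinuousOn.circleIntegrable zero_le_one ((contOn hf).smul fun z hz => ?_)
      exact (h.star.diff hr (by simpa using hz.le)).continuousAt.continuousWithinAt
    have h3 := congrArg (ev x) (h.star.avg hr hf)
    rw [← (ev x).circleAverage_comp_comm hi] at h3
    have h4 : ev x (f 0 • (1 : H →L[ℂ] H)) = f 0 * (‖x‖ ^ 2 : ℝ) := by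
      simp [ev_apply, inner_smul_right, inner_self_eq_norm_sq_to_K]
    rw [← h4, ← h3]
    refine circleAverage_congr_sphere fun z hz => ?_
    have hz1 : ‖z‖ = 1 := by simpa using hz
    have hz2 : z = star z⁻¹ := by
      rw [star_inv₀, eq_comm, inv_eq_of_mul_eq_one_left]
      have := Complex.mul_conj z
      rw [Complex.normSq_eq_norm_sq, hz1] at this
      simpa using this
    have h5 : res (star S) z = star (res S z⁻¹) := by rw [← res_star, ← hz2]
    simp only [Function.comp, h5]
    simp [ev_apply, inner_smul_right, ContinuousLinearMap.star_eq_adjoint,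
      ContinuousLinearMap.adjoint_inner_right]
  have c1 := ev_cont h hr x
  rw [h1, h2, ← circleAverage_fun_add]
  · congr 1; ext z
    rw [← mul_add, Complex.add_conj]
  · exact ((contOn hf).mul c1).circleIntegrable zero_le_one
  · exact ((contOn hf).mul (Complex.continuous_conj.comp_continuousOn c1)).circleIntegrable zero_le_one

lemma key_one {S : H →L[ℂ] H} {r : ℝ} (h : NR S r) (hr : r < 1) (x : H) :
    circleAverage (fun z => 2 * (⟪x, res S z⁻¹ x⟫_ℂ).re) 0 1 = 2 * ‖x‖ ^ 2 := by
  have h1 := key h hr (f := fun _ => 1) diffContOnCl_const x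
  rw [Phi_one h hr] at h1
  have c1 : CircleIntegrable (fun z => 2 * (⟪x, res S z⁻¹ x⟫_ℂ).re) 0 1 :=
    (continuousOn_const.mul
      (Complex.continuous_re.comp_continuousOn (ev_cont h hr x))).circleIntegrable zero_le_one
  have h2 := Complex.ofRealCLM.circleAverage_comp_comm c1
  have h3 : circleAverage (Complex.ofRealCLM ∘ fun z => 2 * (⟪x, res S z⁻¹ x⟫_ℂ).re) 0 1
    = (2 * ‖x‖ ^ 2 : ℝ) := by
    rw [show (Complex.ofRealCLM ∘ fun z => 2 * (⟪x, res S z⁻¹ x⟫_ℂ).re) =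
      fun z => (1 : ℂ) * (2 * (⟪x, res S z⁻¹ x⟫_ℂ).re : ℝ) by ext z; simp, ← h1]
    simp [inner_self_eq_norm_sq_to_K]; ring
  rw [h2] at h3
  exact Complex.ofReal_injective h3

lemma re_nonneg {S : H →L[ℂ] H} {r : ℝ} (h : NR S r) (hr : r < 1) {f : ℂ → ℂ}
    (hf : DiffContOnCl ℂ f (ball 0 1)) (hf0 : f 0 = 1) (hre : ∀ z ∈ sphere (0 : ℂ) 1, 1 / 2 ≤ (f z).re)
    (x : H) : 0 ≤ (⟪x, Phi S f x⟫_ℂ).re := by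
  have h1 := key h hr hf x
  have cr : ContinuousOn (fun z : ℂ => (⟪x, res S z⁻¹ x⟫_ℂ).re) (sphere 0 1) :=
      Complex.continuous_re.comp_continuousOn (ev_cont h hr x)
  have ci : CircleIntegrable (fun z => f z * (2 * (⟪x, res S z⁻¹ x⟫_ℂ).re : ℝ)) 0 1 :=
    ((contOn hf).mul (Complex.continuous_ofReal.comp_continuousOn
      (continuousOn_const.mul cr))).circleIntegrable zero_le_one
  have h2 := congrArg Complex.reCLM h1
  rw [← Complex.reCLM.circleAverage_comp_comm ci] at h2
  have h3 : circleAverage (fun z => (1 / 2 : ℝ) * (2 * (⟪x, res S z⁻¹ x⟫_ℂ).re)) 0 1 ≤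
    circleAverage (Complex.reCLM ∘ fun z => f z * (2 * (⟪x, res S z⁻¹ x⟫_ℂ).re : ℝ)) 0 1 := by
    refine circleAverage_mono ?_ ?_ ?_
    · exact (continuousOn_const.mul (continuousOn_const.mul cr)).circleIntegrable zero_le_one
    · exact (Complex.reCLM.continuous.comp_continuousOn ((contOn hf).mul
        (Complex.continuous_ofReal.comp_continuousOn
        (continuousOn_const.mul cr)))).circleIntegrable zero_le_one
    · intro z hz
      rw [abs_one] at hz
      have hz1 : ‖z‖ = 1 := by simpa using hz
      have p1 := h.re_res hr (z := z⁻¹) (by simp [hz1]) x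
      have : Complex.reCLM (f z * (2 * (⟪x, res S z⁻¹ x⟫_ℂ).re : ℝ))
        = (f z).re * (2 * (⟪x, res S z⁻¹ x⟫_ℂ).re) := by
        rw [Complex.reCLM_apply, Complex.re_mul_ofReal]
      rw [Function.comp, this]
      exact mul_le_mul_of_nonneg_right (hre z hz) (by linarith)
  have h4 := key_one h hr x
  have h5 : circleAverage (fun z => (1 / 2 : ℝ) * (2 * (⟪x, res S z⁻¹ x⟫_ℂ).re)) 0 1 = ‖x‖ ^ 2 := by
    have := circleAverage_fun_smul (a := (1 / 2 : ℝ))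
      (f := fun z => (2 * (⟪x, res S z⁻¹ x⟫_ℂ).re)) (c := 0) (R := 1)
    simp only [smul_eq_mul] at this
    rw [this, h4]; ring
  rw [h5, ← h2, hf0, one_mul, map_add, Complex.reCLM_apply, Complex.reCLM_apply,
    Complex.ofReal_re] at h3
  linarith

lemma three {S : H →L[ℂ] H} {r : ℝ} (h : NR S r) (hr : r < 1) {f : ℂ → ℂ}
    (hf : DiffContOnCl ℂ f (ball 0 1)) {M : ℝ} (hM : ∀ z ∈ closedBall (0 : ℂ) 1, ‖f z‖ ≤ M) :
    NR (Phi S f) (3 * M) := by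
  intro x
  have h1 := key h hr hf x
  have cr : ContinuousOn (fun z : ℂ => (⟪x, res S z⁻¹ x⟫_ℂ).re) (sphere 0 1) :=
      Complex.continuous_re.comp_continuousOn (ev_cont h hr x)
  have h3 : ‖circleAverage (fun z => f z * (2 * (⟪x, res S z⁻¹ x⟫_ℂ).re : ℝ)) 0 1‖ ≤
      circleAverage (fun z => M * (2 * (⟪x, res S z⁻¹ x⟫_ℂ).re)) 0 1 := by
    have h4 : ‖circleAverage (fun z => f z * (2 * (⟪x, res S z⁻¹ x⟫_ℂ).re : ℝ)) 0 1‖ ≤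
      circleAverage (fun z => ‖f z * (2 * (⟪x, res S z⁻¹ x⟫_ℂ).re : ℝ)‖) 0 1 := by
      rw [circleAverage, circleAverage, norm_smul, smul_eq_mul,
        Real.norm_of_nonneg (by positivity)]
      gcongr
      exact intervalIntegral.norm_integral_le_integral_norm two_pi_pos.le
    refine h4.trans (circleAverage_mono ?_ ?_ ?_)
    · exact ((contOn hf).mul (Complex.continuous_ofReal.comp_continuousOn
        (continuousOn_const.mul cr))).norm.circleIntegrable zero_le_one
    · exact (continuousOn_const.mul (continuousOn_const.mul cr)).circleIntegrable zero_le_one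
    · intro z hz
      rw [abs_one] at hz
      have hz1 : ‖z‖ = 1 := by simpa using hz
      have p1 := h.re_res hr (z := z⁻¹) (by simp [hz1]) x
      rw [norm_mul, Complex.norm_real, Real.norm_of_nonneg (by linarith)]
      exact mul_le_mul_of_nonneg_right (hM z (sphere_subset_closedBall hz)) (by linarith)
  have h5 : circleAverage (fun z => M * (2 * (⟪x, res S z⁻¹ x⟫_ℂ).re)) 0 1 = M * (2 * ‖x‖ ^ 2) := by
    have := circleAverage_fun_smul (a := M)
      (f := fun z => (2 * (⟪x, res S z⁻¹ x⟫_ℂ).re)) (c := 0) (R := 1)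
    simp only [smul_eq_mul] at this
    rw [this, key_one h hr x]
  rw [h5, ← h1] at h3
  have h6 : ‖f 0 * (‖x‖ ^ 2 : ℝ)‖ ≤ M * ‖x‖ ^ 2 := by
    rw [norm_mul, Complex.norm_real, Real.norm_of_nonneg (by positivity)]
    gcongr
    exact hM 0 (by simp)
  have h7 := norm_sub_le (⟪x, Phi S f x⟫_ℂ + f 0 * (‖x‖ ^ 2 : ℝ)) (f 0 * (‖x‖ ^ 2 : ℝ))
  rw [add_sub_cancel_right] at h7
  linarith

lemma poly_bound {S : H →L[ℂ] H} {r : ℝ} (h : NR S r) (hr : r < 1) (p : Polynomial ℂ)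
    (hp : p.eval 0 = 0) {M : ℝ} (hM : ∀ z ∈ closedBall (0 : ℂ) 1, ‖p.eval z‖ ≤ M) :
    ∀ x : H, ‖x‖ = 1 → ‖⟪x, Polynomial.aeval S p x⟫_ℂ‖ ≤ M := by
  intro x hx
  have hM0 : 0 ≤ M := (norm_nonneg _).trans (hM 0 (by simp))
  by_contra! hlt
  obtain ⟨N, hN1, hN2⟩ := exists_between hlt
  set w := ⟪x, Polynomial.aeval S p x⟫_ℂ with hw
  have hN0 : 0 < N := by linarith
  have hw0 : w ≠ 0 := by rw [← norm_pos_iff]; linarith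
  set l : ℂ := (‖w‖ : ℂ) / (N * w) with hl
  have hln : ‖l‖ = 1 / N := by
    rw [hl, norm_div, norm_mul, Complex.norm_real, Complex.norm_real, norm_norm,
      Real.norm_of_nonneg hN0.le]
    have : ‖w‖ ≠ 0 := norm_ne_zero_iff.2 hw0
    field_simp
  have hlw : l * w = (‖w‖ / N : ℝ) := by
    rw [hl]; push_cast
    have : (N : ℂ) ≠ 0 := by exact_mod_cast hN0.ne'
    field_simp
  set q : Polynomial ℂ := 1 - Polynomial.C l * p with hq
  have hsm : ∀ z ∈ closedBall (0 : ℂ) 1, ‖l * p.eval z‖ < 1 := by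
    intro z hz
    rw [norm_mul, hln, one_div, inv_mul_lt_iff₀ hN0]
    linarith [hM z hz]
  have hqe : ∀ z, q.eval z = 1 - l * p.eval z := by intro z; simp [hq]
  have hqne : ∀ z ∈ closedBall (0 : ℂ) 1, q.eval z ≠ 0 := by
    intro z hz h0
    rw [hqe, sub_eq_zero] at h0
    have := hsm z hz
    rw [← h0] at this; simp at this
  have hg : DiffContOnCl ℂ (fun z => (q.eval z)⁻¹) (ball 0 1) := by
    refine DifferentiableOn.diffContOnCl fun z hz => ?_
    rw [closure_ball _ one_ne_zero] at hz
    exact (q.differentiable.differentiableAt.inv (hqne z hz)).differentiableWithinAt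
  have hone : Phi S (fun z => (q.eval z)⁻¹) * Polynomial.aeval S q = 1 := by
    rw [Phi_mul_poly h hr hg q, ← Phi_one h hr, Phi, Phi]
    refine circleAverage_congr_sphere fun z hz => ?_
    rw [abs_one] at hz
    simp [mul_inv_cancel₀ (hqne z (sphere_subset_closedBall hz))]
  have hpos := re_nonneg h hr hg (by simp [hqe, hp]) (fun z hz => ?_) (Polynomial.aeval S q x)
  · have h1 : Phi S (fun z => (q.eval z)⁻¹) (Polynomial.aeval S q x) = x :=
      congrArg (fun A : H →L[ℂ] H => A x) hone
    rw [h1, ← inner_conj_symm, Complex.conj_re] at hpos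
    have h2 : ⟪x, Polynomial.aeval S q x⟫_ℂ = ((1 - ‖w‖ / N : ℝ) : ℂ) := by
      have : Polynomial.aeval S q x = x - l • Polynomial.aeval S p x := by
        simp [hq, Algebra.algebraMap_eq_smul_one]
      rw [this, inner_sub_right, inner_smul_right, ← hw, hlw, inner_self_eq_norm_sq_to_K, hx]
      simp
    rw [h2, Complex.ofReal_re] at hpos
    have : 1 < ‖w‖ / N := by rwa [one_lt_div hN0]
    linarith
  · have hzb := sphere_subset_closedBall hz
    have hs := hsm z hzb
    have hne := hqne z hzb
    rw [hqe] at hne ⊢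
    set u := l * p.eval z with hu
    rw [Complex.inv_re, le_div_iff₀ (Complex.normSq_pos.2 hne)]
    have h3 : Complex.normSq u < 1 := by
      rw [Complex.normSq_eq_norm_sq]; nlinarith [norm_nonneg u]
    rw [Complex.normSq_apply] at h3 ⊢
    simp only [Complex.sub_re, Complex.sub_im, Complex.one_re, Complex.one_im]
    nlinarith

lemma NR.norm_le {A : H →L[ℂ] H} {M : ℝ} (hM : 0 ≤ M) (h : NR A M) : ‖A‖ ≤ 4 * M := by
  have hq : ∀ u : H, ‖⟪A u, u⟫_ℂ‖ ≤ M * ‖u‖ ^ 2 := fun u => by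
    rw [norm_inner_symm]; exact h u
  have key : ∀ x y : H, ‖x‖ ≤ 1 → ‖y‖ ≤ 1 → ‖⟪A y, x⟫_ℂ‖ ≤ 4 * M := by
    intro x y hx hy
    have hb : ∀ u : H, ‖u‖ ≤ 2 → ‖⟪A u, u⟫_ℂ‖ ≤ M * 4 := fun u hu => by
      refine (hq u).trans ?_
      gcongr
      nlinarith [norm_nonneg u]
    have e := inner_map_polarization (A : H →ₗ[ℂ] H) x y
    simp only [ContinuousLinearMap.coe_coe] at e
    have hI : ‖Complex.I • y‖ ≤ 1 := by simpa [norm_smul] using hy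
    have b1 := hb (x + y) (by linarith [norm_add_le x y])
    have b2 := hb (x - y) (by linarith [norm_sub_le x y])
    have b3 := hb (x + Complex.I • y) (by linarith [norm_add_le x (Complex.I • y)])
    have b4 := hb (x - Complex.I • y) (by linarith [norm_sub_le x (Complex.I • y)])
    rw [e, norm_div]
    have n4 : ‖(4 : ℂ)‖ = 4 := by norm_num
    rw [n4, div_le_iff₀ (by norm_num)]
    refine (norm_sub_le _ _).trans ?_
    refine (add_le_add_left (norm_add_le _ _) _).trans ?_
    refine (add_le_add_left (add_le_add_left (norm_sub_le _ _) _) _).trans ?_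
    rw [norm_mul, norm_mul, Complex.norm_I]
    linarith
  refine A.opNorm_le_of_unit_norm (by positivity) fun y hy => ?_
  by_cases h0 : A y = 0
  · rw [h0, norm_zero]; positivity
  have hn : ‖A y‖ ≠ 0 := norm_ne_zero_iff.2 h0
  have := key ((‖A y‖ : ℂ)⁻¹ • A y) y (by simp [norm_smul, hn]) hy.le
  rw [inner_smul_right, inner_self_eq_norm_sq_to_K, norm_mul, norm_inv, norm_pow] at this
  simp only [Complex.norm_real, norm_norm, Complex.coe_algebraMap] at this
  calc ‖A y‖ = ‖A y‖⁻¹ * ‖A y‖ ^ 2 := by field_simp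
    _ ≤ _ := by simpa using this

lemma approx {f : ℂ → ℂ} (hf : DiffContOnCl ℂ f (ball 0 1)) (hf0 : f 0 = 0) {ε : ℝ} (hε : 0 < ε) :
    ∃ p : Polynomial ℂ, p.eval 0 = 0 ∧ ∀ z ∈ closedBall (0 : ℂ) 1, ‖f z - p.eval z‖ ≤ ε := by
  suffices h : ∃ p : Polynomial ℂ, ∀ z ∈ closedBall (0 : ℂ) 1, ‖f z - p.eval z‖ ≤ ε / 2 by
    obtain ⟨p, hp⟩ := h
    refine ⟨p - Polynomial.C (p.eval 0), by simp, fun z hz => ?_⟩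
    have h0 := hp 0 (by simp)
    rw [hf0, zero_sub, norm_neg] at h0
    have : f z - (p - Polynomial.C (p.eval 0)).eval z = (f z - p.eval z) + p.eval 0 := by
      simp; ring
    rw [this]
    linarith [norm_add_le (f z - p.eval z) (p.eval 0), hp z hz]
  have huc := (isCompact_closedBall (0 : ℂ) 1).uniformContinuousOn_of_continuous
    hf.continuousOn_ball
  obtain ⟨δ, hδ, hu⟩ := Metric.uniformContinuousOn_iff.1 huc (ε / 4) (by linarith)
  obtain ⟨ρ, hρ1, hρ2⟩ := exists_between (max_lt (sub_lt_self (1 : ℝ) hδ) one_half_lt_one)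
  have hρ0 : 0 < ρ := by linarith [le_max_right (1 - δ) (1 / 2)]
  have hρd : 1 - ρ < δ := by linarith [le_max_left (1 - δ) (1 / 2)]
  obtain ⟨ρ', hρ3, hρ4⟩ := exists_between hρ2
  have hps := DiffContOnCl.hasFPowerSeriesOnBall (R := 1) (c := 0) (f := f)
    (by simpa using hf) one_pos
  obtain ⟨a, ha, C, hC, hap⟩ := hps.uniform_geometric_approx (r' := Real.toNNReal ρ')
    (by simpa using hρ4)
  set P := cauchyPowerSeries f 0 ((1 : NNReal) : ℝ) with hP
  have hlim : Filter.Tendsto (fun n : ℕ => C * a ^ n) Filter.atTop (nhds (C * 0)) :=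
    (tendsto_pow_atTop_nhds_zero_of_lt_one ha.1.le ha.2).const_mul C
  rw [mul_zero] at hlim
  obtain ⟨n, hn⟩ := (hlim.eventually (gt_mem_nhds (show 0 < ε / 4 by linarith))).exists
  refine ⟨∑ k ∈ Finset.range n, Polynomial.C (P.coeff k * ρ ^ k) * Polynomial.X ^ k,
    fun z hz => ?_⟩
  have hz1 : ‖z‖ ≤ 1 := by simpa using hz
  have hρz : ‖(ρ : ℂ) * z‖ ≤ ρ := by
    rw [norm_mul, Complex.norm_real, Real.norm_of_nonneg hρ0.le]
    nlinarith
  have h1 := hap ((ρ : ℂ) * z) (by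
    rw [mem_ball_zero_iff, Real.coe_toNNReal _ (by linarith)]; linarith) n
  have h2 : P.partialSum n ((ρ : ℂ) * z) =
      (∑ k ∈ Finset.range n, Polynomial.C (P.coeff k * ρ ^ k) * Polynomial.X ^ k).eval z := by
    rw [FormalMultilinearSeries.partialSum, Polynomial.eval_finsetSum]
    refine Finset.sum_congr rfl fun k _ => ?_
    rw [FormalMultilinearSeries.apply_eq_pow_smul_coeff]
    simp; ring
  rw [h2, zero_add] at h1
  have h3 := hu z hz ((ρ : ℂ) * z) (by simp only [mem_closedBall_zero_iff]; linarith) (by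
    rw [dist_eq_norm, show z - (ρ : ℂ) * z = ((1 - ρ : ℝ) : ℂ) * z by push_cast; ring, norm_mul,
      Complex.norm_real, Real.norm_of_nonneg (by linarith)]
    nlinarith)
  rw [dist_eq_norm] at h3
  have h4 := norm_add_le (f z - f ((ρ : ℂ) * z)) (f ((ρ : ℂ) * z) -
    (∑ k ∈ Finset.range n, Polynomial.C (P.coeff k * ρ ^ k) * Polynomial.X ^ k).eval z)
  rw [sub_add_sub_cancel] at h4
  linarith

lemma F_eq (T : H →L[ℂ] H) (f : ℂ → ℂ) (r : ℝ) :
    (2 * (Real.pi : ℂ) * Complex.I)⁻¹ •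
        (∮ z in C(0, 1), f z • Ring.inverse (z • (1 : H →L[ℂ] H) - (r : ℂ) • T))
      = Phi ((r : ℂ) • T) f := by
  rw [Phi, circleAverage_eq_circleIntegral one_ne_zero]
  congr 1
  refine circleIntegral.integral_congr zero_le_one fun z hz => ?_
  have hz1 : ‖z‖ = 1 := by simpa using hz
  have hz0 : z ≠ 0 := by rintro rfl; simp at hz1
  have h1 : z • (1 : H →L[ℂ] H) - (r : ℂ) • T
      = (z • (1 : H →L[ℂ] H)) * (1 - z⁻¹ • (r : ℂ) • T) := by
    rw [smul_one_mul, smul_sub, smul_inv_smul₀ hz0]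
  have h2 : Ring.inverse (z • (1 : H →L[ℂ] H)) = z⁻¹ • 1 := by
    exact Ring.inverse_unit (⟨z • (1 : H →L[ℂ] H), z⁻¹ • 1, by simp [smul_smul, hz0],
      by simp [smul_smul, hz0]⟩ : (H →L[ℂ] H)ˣ)
  have h3 : Ring.inverse (z • (1 : H →L[ℂ] H) - (r : ℂ) • T) = z⁻¹ • res ((r : ℂ) • T) z⁻¹ := by
    rw [h1, Ring.mul_inverse_rev', h2, res]
    · simp
    · exact (Commute.one_left _).smul_left z
  simp only [h3, sub_zero]
  rw [smul_comm]

end BS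

open BS
theorem stmt4 {H : Type*} [NormedAddCommGroup H] [InnerProductSpace ℂ H] [CompleteSpace H]
    (T : H →L[ℂ] H)
    (hw : ∀ x : H, ‖x‖ = 1 → ‖⟪x, T x⟫_ℂ‖ ≤ 1)
    (f : ℂ → ℂ)
    (hf_cont : ContinuousOn f (Metric.closedBall 0 1))
    (hf_hol : DifferentiableOn ℂ f (Metric.ball 0 1))
    (hf0 : f 0 = 0)
    (F : ℝ → (H →L[ℂ] H))
    (hF : ∀ r : ℝ, F r = (2 * (Real.pi : ℂ) * Complex.I)⁻¹ •
        ∮ z in C(0, 1), f z • Ring.inverse (z • (1 : H →L[ℂ] H) - (r : ℂ) • T)) :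
    ∃ fT : H →L[ℂ] H,
      Filter.Tendsto F (nhdsWithin 1 (Set.Iio 1)) (nhds fT) ∧
      ∀ x : H, ‖x‖ = 1 →
        ‖⟪x, fT x⟫_ℂ‖ ≤ sSup ((fun z => ‖f z‖) '' Metric.closedBall 0 1) := by
  have hf : DiffContOnCl ℂ f (Metric.ball 0 1) :=
    ⟨hf_hol, by rwa [closure_ball _ one_ne_zero]⟩
  have hT : NR T 1 := by
    intro x
    by_cases hx : x = 0
    · simp [hx]
    have hn : (‖x‖ : ℂ) ≠ 0 := by simpa using hx
    have h1 := hw ((‖x‖ : ℂ)⁻¹ • x) (by simp [norm_smul, hx])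
    rw [map_smul, inner_smul_left, inner_smul_right, norm_mul, norm_mul, RCLike.norm_conj,
      norm_inv, Complex.norm_real, norm_norm] at h1
    have hp : 0 < ‖x‖ := norm_pos_iff.2 hx
    calc ‖⟪x, T x⟫_ℂ‖ = (‖x‖⁻¹ * (‖x‖⁻¹ * ‖⟪x, T x⟫_ℂ‖)) * ‖x‖ ^ 2 := by field_simp
      _ ≤ 1 * ‖x‖ ^ 2 := by gcongr
  have hrT : ∀ r : ℝ, 0 < r → NR ((r : ℂ) • T) r := by
    intro r hr x
    rw [ContinuousLinearMap.smul_apply, inner_smul_right, norm_mul, Complex.norm_real,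
      Real.norm_of_nonneg hr.le]
    have := hT x
    rw [one_mul] at this
    gcongr
  have hFP : ∀ r : ℝ, F r = Phi ((r : ℂ) • T) f := fun r => by rw [hF, F_eq]
  have happ : ∀ (p : Polynomial ℂ) (ε : ℝ), 0 < ε →
      (∀ z ∈ Metric.closedBall (0 : ℂ) 1, ‖f z - p.eval z‖ ≤ ε) →
      ∀ r : ℝ, 0 < r → r < 1 → ‖F r - Polynomial.aeval ((r : ℂ) • T) p‖ ≤ 12 * ε := by
    intro p ε hε hp r hr0 hr1
    rw [hFP, ← Phi_poly (hrT r hr0) hr1 p,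
      ← Phi_sub (hrT r hr0) hr1 (contOn hf) (contOn (poly_da p))]
    have := (three (hrT r hr0) hr1 (hf.sub (poly_da p)) hp).norm_le (by positivity)
    calc _ ≤ 4 * (3 * ε) := this
      _ = _ := by ring
  have hev : ∀ᶠ r : ℝ in nhdsWithin 1 (Set.Iio 1), 0 < r ∧ r < 1 := by
    have h1 : ∀ᶠ r : ℝ in nhdsWithin 1 (Set.Iio 1), 0 < r :=
      nhdsWithin_le_nhds (lt_mem_nhds one_pos)
    exact h1.and self_mem_nhdsWithin
  have hlimit : ∃ fT, Filter.Tendsto F (nhdsWithin 1 (Set.Iio 1)) (nhds fT) := by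
    rw [← cauchy_map_iff_exists_tendsto, Metric.cauchy_iff]
    refine ⟨inferInstance, fun ε hε => ?_⟩
    obtain ⟨p, -, hp⟩ := approx hf hf0 (ε := ε / 60) (by positivity)
    have hc : Filter.Tendsto (fun r : ℝ => Polynomial.aeval ((r : ℂ) • T) p)
        (nhdsWithin 1 (Set.Iio 1)) (nhds (Polynomial.aeval T p)) := by
      have : Continuous (fun r : ℝ => Polynomial.aeval ((r : ℂ) • T) p) :=
        p.continuous_aeval.comp (Complex.continuous_ofReal.smul continuous_const)
      have := (this.tendsto 1).mono_left (nhdsWithin_le_nhds (s := Set.Iio 1))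
      simpa using this
    refine ⟨Metric.ball (Polynomial.aeval T p) (ε / 2), ?_, fun A hA B hB => ?_⟩
    · rw [Filter.mem_map]
      filter_upwards [hev, hc.eventually (Metric.ball_mem_nhds _ (show 0 < ε / 4 by linarith))]
        with r hr hb
      have h1 := happ p _ (by positivity) hp r hr.1 hr.2
      rw [← dist_eq_norm] at h1
      simp only [Set.mem_preimage, Metric.mem_ball]
      linarith [dist_triangle (F r) (Polynomial.aeval ((r : ℂ) • T) p) (Polynomial.aeval T p)]
    · rw [Metric.mem_ball] at hA hB
      linarith [dist_triangle_right A B (Polynomial.aeval T p)]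
  obtain ⟨fT, hfT⟩ := hlimit
  refine ⟨fT, hfT, fun x hx => ?_⟩
  set M := sSup ((fun z => ‖f z‖) '' Metric.closedBall 0 1) with hM
  have hMb : ∀ z ∈ Metric.closedBall (0 : ℂ) 1, ‖f z‖ ≤ M := fun z hz =>
    le_csSup ((isCompact_closedBall (0 : ℂ) 1).image_of_continuousOn hf_cont.norm).bddAbove
      ⟨z, hz, rfl⟩
  have ht : Filter.Tendsto (fun r => ‖⟪x, F r x⟫_ℂ‖) (nhdsWithin 1 (Set.Iio 1))
      (nhds ‖⟪x, fT x⟫_ℂ‖) :=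
    (((ev x).continuous.tendsto fT).comp hfT).norm
  refine le_of_tendsto ht ?_
  filter_upwards [hev] with r hr
  refine le_of_forall_pos_le_add fun ε hε => ?_
  obtain ⟨p, hp0, hp⟩ := approx hf hf0 (ε := ε / 13) (by positivity)
  have h1 := happ p _ (by positivity) hp r hr.1 hr.2
  have h2 := poly_bound (hrT r hr.1) hr.2 p hp0 (M := M + ε / 13) (fun z hz => by
    have := norm_sub_le (f z) (f z - p.eval z)
    rw [sub_sub_cancel] at this
    linarith [hMb z hz, hp z hz]) x hx
  have h3 : ‖⟪x, (F r - Polynomial.aeval ((r : ℂ) • T) p) x⟫_ℂ‖ ≤ 12 * (ε / 13) := by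
    refine (norm_inner_le_norm _ _).trans ?_
    rw [hx, one_mul]
    refine (ContinuousLinearMap.le_opNorm _ _).trans ?_
    rw [hx, mul_one]; exact h1
  rw [ContinuousLinearMap.sub_apply, inner_sub_right] at h3
  have h4 := norm_add_le (⟪x, F r x⟫_ℂ - ⟪x, Polynomial.aeval ((r : ℂ) • T) p x⟫_ℂ)
    ⟪x, Polynomial.aeval ((r : ℂ) • T) p x⟫_ℂ
  rw [sub_add_cancel] at h4
  linarith
end

section
/- Let T be a bounded operator on a complex Hilbert space with w(T) ≤ 1. Then for every t ∈ [0, 1/2], the operator I + t(T + T*) + (t² - 1/4) T*T is positive semidefinite. -/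
open scoped InnerProductSpace

lemma re_nonneg_of_circle (c0 c1 c2 : ℂ)
    (h : ∀ z : ℂ, ‖z‖ = 1 → 0 ≤ (c0 + z * c1 + z ^ 2 * c2).re) (s : ℂ) (hs : ‖s‖ ≤ 1) :
    0 ≤ (c0 + s * c1 + s ^ 2 * c2).re := by
  have hd : DiffContOnCl ℂ (fun z : ℂ => Complex.exp (-(c0 + z * c1 + z ^ 2 * c2)))
      (Metric.ball 0 1) := by
    apply Differentiable.diffContOnCl
    fun_prop
  have := Complex.norm_le_of_forall_mem_frontier_norm_le (C := 1) Metric.isBounded_ball hd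
    (by
      intro z hz
      rw [frontier_ball _ one_ne_zero] at hz
      have hz1 : ‖z‖ = 1 := by simpa using hz
      have := h z hz1
      rw [Complex.norm_exp, Real.exp_le_one_iff, Complex.neg_re]
      linarith) (z := s) (by rw [closure_ball _ one_ne_zero]; simpa using hs)
  rw [Complex.norm_exp, Real.exp_le_one_iff, Complex.neg_re] at this
  linarith

lemma key_norm {H : Type*} [NormedAddCommGroup H] [InnerProductSpace ℂ H]
    (T : H →L[ℂ] H)
    (hw : ∀ y : H, ‖y‖ = 1 → ‖⟪y, T y⟫_ℂ‖ ≤ 1) (s : ℝ) (h0 : 0 ≤ s) (h1 : s ≤ 1) (x : H) :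
    0 ≤ (⟪(s : ℂ) • T x + (2 : ℂ) • x, (s : ℂ) • T x + (2 : ℂ) • x⟫_ℂ - ⟪T x, T x⟫_ℂ).re := by
  have hw2 : ∀ v : H, ‖⟪v, T v⟫_ℂ‖ ≤ ‖v‖ ^ 2 := by
    intro v
    by_cases hv : v = 0
    · simp [hv]
    have hn : 0 < ‖v‖ := norm_pos_iff.mpr hv
    have := hw (((‖v‖⁻¹ : ℝ) : ℂ) • v) (by
      rw [norm_smul, Complex.norm_real, norm_inv, norm_norm, inv_mul_cancel₀ hn.ne'])
    rw [map_smul, inner_smul_left, inner_smul_right, norm_mul, norm_mul, Complex.conj_ofReal,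
      Complex.norm_real, norm_inv, norm_norm, ← mul_assoc, ← mul_inv, inv_mul_le_iff₀ (by positivity)] at this
    linarith
  obtain ⟨y, hy⟩ : ∃ y, y = T x := ⟨_, rfl⟩
  obtain ⟨d, hd⟩ : ∃ d, d = (s : ℂ) • y + (2 : ℂ) • x := ⟨_, rfl⟩
  have hTd : T d = (s : ℂ) • T y + (2 : ℂ) • y := by rw [hd, map_add, map_smul, map_smul, ← hy]
  have := re_nonneg_of_circle (⟪y, y⟫_ℂ + ⟪d, d⟫_ℂ - ⟪y, T d⟫_ℂ)
    (-2 * ⟪d, y⟫_ℂ + ⟪y, T y⟫_ℂ + ⟪d, T d⟫_ℂ) (-⟪d, T y⟫_ℂ) (by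
      intro z hz
      have hzz : z * (starRingEnd ℂ) z = 1 := by
        rw [Complex.mul_conj, Complex.normSq_eq_norm_sq, hz]; simp
      have hv := hw2 (z • y - d)
      have h3 : -(z * ⟪z • y - d, T (z • y - d)⟫_ℂ).re ≤ ‖z • y - d‖ ^ 2 := by
        refine le_trans ?_ hv
        have := Complex.abs_re_le_norm (z * ⟪z • y - d, T (z • y - d)⟫_ℂ)
        rw [norm_mul, hz, one_mul] at this
        exact (neg_le_abs _).trans this
      have h4 : ‖z • y - d‖ ^ 2 = (⟪z • y - d, z • y - d⟫_ℂ).re :=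
        (inner_self_eq_norm_sq (𝕜 := ℂ) (z • y - d)).symm
      have h5 : ⟪z • y - d, z • y - d⟫_ℂ
          = ⟪y, y⟫_ℂ + ⟪d, d⟫_ℂ - z * ⟪d, y⟫_ℂ - (starRingEnd ℂ) (z * ⟪d, y⟫_ℂ) := by
        simp only [inner_sub_left, inner_sub_right, inner_smul_left, inner_smul_right, map_mul,
          inner_conj_symm]
        linear_combination ⟪y, y⟫_ℂ * hzz
      have h6 : z * ⟪z • y - d, T (z • y - d)⟫_ℂ
          = z * ⟪y, T y⟫_ℂ - ⟪y, T d⟫_ℂ - z ^ 2 * ⟪d, T y⟫_ℂ + z * ⟪d, T d⟫_ℂ := by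
        simp only [map_sub, map_smul, inner_sub_left, inner_sub_right, inner_smul_left,
          inner_smul_right]
        linear_combination (z * ⟪y, T y⟫_ℂ - ⟪y, T d⟫_ℂ) * hzz
      rw [h4, h5, h6] at h3
      have h7 : ⟪y, y⟫_ℂ + ⟪d, d⟫_ℂ - ⟪y, T d⟫_ℂ
          + z * (-2 * ⟪d, y⟫_ℂ + ⟪y, T y⟫_ℂ + ⟪d, T d⟫_ℂ) + z ^ 2 * (-⟪d, T y⟫_ℂ)
          = (⟪y, y⟫_ℂ + ⟪d, d⟫_ℂ - z * ⟪d, y⟫_ℂ - z * ⟪d, y⟫_ℂ) +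
          (z * ⟪y, T y⟫_ℂ - ⟪y, T d⟫_ℂ - z ^ 2 * ⟪d, T y⟫_ℂ + z * ⟪d, T d⟫_ℂ) := by ring
      rw [h7]
      simp only [Complex.add_re, Complex.sub_re, Complex.conj_re] at h3 ⊢
      linarith) (s : ℂ) (by rw [Complex.norm_real, Real.norm_of_nonneg h0]; exact h1)
  rw [← hy, ← hd]
  convert this using 2
  rw [hTd]
  simp only [inner_add_right, inner_smul_right]
  ring

/-- Theorem 3.2: if `w(T) ≤ 1`, then for all `t ∈ [0, 1/2]` the operator
`I + t(T + T*) + (t² - 1/4) T*T` is positive semidefinite. -/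
theorem stmt9 {H : Type*} [NormedAddCommGroup H] [InnerProductSpace ℂ H] [CompleteSpace H]
    (T : H →L[ℂ] H)
    (hw : ∀ y : H, ‖y‖ = 1 → ‖⟪y, T y⟫_ℂ‖ ≤ 1) :
    ∀ t : ℝ, t ∈ Set.Icc (0 : ℝ) (1 / 2) →
      ((1 : H →L[ℂ] H) + (t : ℂ) • (T + ContinuousLinearMap.adjoint T) +
        ((t ^ 2 - 1 / 4 : ℝ) : ℂ) • (ContinuousLinearMap.adjoint T * T)).IsPositive := by
  rintro t ⟨ht0, ht1⟩
  rw [ContinuousLinearMap.isPositive_def']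
  constructor
  · rw [IsSelfAdjoint]
    simp only [← ContinuousLinearMap.star_eq_adjoint, star_add, star_smul, star_mul, star_star,
      star_one, Complex.star_def, Complex.conj_ofReal]
    rw [add_comm (star T) T]
  · intro x
    have := key_norm T hw (2 * t) (by linarith) (by linarith) x
    have e : ⟪((2 * t : ℝ) : ℂ) • T x + (2 : ℂ) • x, ((2 * t : ℝ) : ℂ) • T x + (2 : ℂ) • x⟫_ℂ
        - ⟪T x, T x⟫_ℂ = ((4 : ℝ) : ℂ) * ⟪((1 : H →L[ℂ] H) + (t : ℂ) • (T + ContinuousLinearMap.adjoint T) +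
        ((t ^ 2 - 1 / 4 : ℝ) : ℂ) • (ContinuousLinearMap.adjoint T * T)) x, x⟫_ℂ := by
      simp only [ContinuousLinearMap.add_apply, ContinuousLinearMap.smul_apply,
        ContinuousLinearMap.one_apply, ContinuousLinearMap.mul_apply,
        inner_add_left, inner_add_right, inner_smul_left, inner_smul_right,
        ContinuousLinearMap.adjoint_inner_left, Complex.conj_ofReal, map_ofNat]
      push_cast
      ring
    rw [e, Complex.re_ofReal_mul] at this
    rw [ContinuousLinearMap.reApplyInnerSelf_apply]
    change 0 ≤ Complex.re _
    linarith
end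

section
/- Let T be a bounded operator on a complex Hilbert space with w(T) ≤ 1, and let x with ‖x‖ ≤ 1. Let θ be the hermitian angle between x and Tx, i.e. cos θ = |⟨Tx,x⟩|/(‖Tx‖‖x‖) (when Tx, x ≠ 0). Then ‖Tx‖ ≤ max{2|sin θ|, √2}. -/
open scoped InnerProductSpace

lemma core_real (a b c q r : ℝ) (ha : |a| ≤ 1)
    (h1 : ∀ l : ℝ, |a + l * (b + c) + l ^ 2 * q| ≤ 1 + l ^ 2)
    (h2 : ∀ l : ℝ, |l * (b - c) + l ^ 2 * r| ≤ 1 + l ^ 2) :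
    c ≤ 1 + Real.sqrt (1 - a ^ 2) := by
  have ha' := abs_le.1 ha
  have e1 := (abs_le.1 (h2 1)).1
  have e2 := (abs_le.1 (h2 (-1))).2
  have d1 : discrim (1 - q) (-(b + c)) (1 - a) ≤ 0 := discrim_le_zero (fun l => by
    have := (abs_le.1 (h1 l)).2
    nlinarith)
  have d2 : discrim (1 + q) (b + c) (1 + a) ≤ 0 := discrim_le_zero (fun l => by
    have := (abs_le.1 (h1 l)).1
    nlinarith)
  unfold discrim at d1 d2
  have h3 : ((b + c) / 2) ^ 2 ≤ 1 - a ^ 2 := by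
    nlinarith [mul_nonneg (by linarith : (0 : ℝ) ≤ 1 + a) (neg_nonneg.2 d1),
      mul_nonneg (by linarith : (0 : ℝ) ≤ 1 - a) (neg_nonneg.2 d2)]
  have h4 := Real.le_sqrt_of_sq_le h3
  linarith

lemma core_vec {H : Type*} [NormedAddCommGroup H] [InnerProductSpace ℂ H]
    (S : H →L[ℂ] H) (hw : ∀ y : H, ‖⟪y, S y⟫_ℂ‖ ≤ ‖y‖ ^ 2)
    (x z : H) (hx : ‖x‖ = 1) (hz : ‖z‖ = 1) (hxz : ⟪x, z⟫_ℂ = 0) (a c : ℝ)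
    (hS : S x = (a : ℂ) • x + (c : ℂ) • z) : c ≤ 1 + Real.sqrt (1 - a ^ 2) := by
  have hzx : ⟪z, x⟫_ℂ = 0 := by rw [← inner_conj_symm, hxz]; simp
  have hxx : ⟪x, x⟫_ℂ = 1 := by simp [inner_self_eq_norm_sq_to_K, hx]
  have hzz : ⟪z, z⟫_ℂ = 1 := by simp [inner_self_eq_norm_sq_to_K, hz]
  have key : ∀ l : ℂ, ‖(a : ℂ) + l * ⟪x, S z⟫_ℂ + (starRingEnd ℂ l) * c
      + (starRingEnd ℂ l) * l * ⟪z, S z⟫_ℂ‖ ≤ 1 + ‖l‖ ^ 2 := by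
    intro l
    have h := hw (x + l • z)
    have hn : ‖x + l • z‖ ^ 2 = 1 + ‖l‖ ^ 2 := by
      have := norm_add_sq_eq_norm_sq_add_norm_sq_of_inner_eq_zero (𝕜 := ℂ) x (l • z)
        (by simp [inner_smul_right, hxz])
      rw [norm_smul, hx, hz] at this
      nlinarith
    rw [hn] at h
    convert h using 2
    simp only [map_add, map_smul, hS, inner_add_left, inner_add_right, inner_smul_left,
      inner_smul_right, hxx, hzz, hxz, hzx]
    ring
  apply core_real a (⟪x, S z⟫_ℂ).re c (⟪z, S z⟫_ℂ).re (⟪z, S z⟫_ℂ).im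
  · have := key 0
    simpa using this
  · intro l
    have h := (Complex.abs_re_le_norm _).trans (key l)
    have hn : ‖(l : ℂ)‖ ^ 2 = l ^ 2 := by simp
    rw [hn] at h
    refine le_trans (le_of_eq (congrArg _ ?_)) h
    simp only [Complex.add_re, Complex.mul_re, Complex.mul_im, Complex.ofReal_re,
      Complex.ofReal_im, Complex.conj_ofReal]
    ring
  · intro l
    have h := (Complex.abs_im_le_norm _).trans (key (l * Complex.I))
    have hn : ‖(l * Complex.I : ℂ)‖ ^ 2 = l ^ 2 := by simp
    rw [hn] at h
    refine le_trans (le_of_eq (congrArg _ ?_)) h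
    simp only [Complex.add_im, Complex.mul_re, Complex.mul_im, Complex.ofReal_re,
      Complex.ofReal_im, Complex.conj_ofReal, map_mul, Complex.conj_I, Complex.I_re,
      Complex.I_im, Complex.neg_re, Complex.neg_im]
    ring

lemma core_unit {H : Type*} [NormedAddCommGroup H] [InnerProductSpace ℂ H]
    (T : H →L[ℂ] H) (hw : ∀ y : H, ‖y‖ = 1 → ‖⟪y, T y⟫_ℂ‖ ≤ 1)
    (x : H) (hx : ‖x‖ = 1) :
    ‖T x‖ ^ 2 ≤ 2 + 2 * Real.sqrt (1 - ‖⟪x, T x⟫_ℂ‖ ^ 2) := by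
  obtain ⟨w, hw1, hwa⟩ : ∃ w : ℂ, ‖w‖ = 1 ∧ w * ⟪x, T x⟫_ℂ = (‖⟪x, T x⟫_ℂ‖ : ℂ) := by
    by_cases h0 : ⟪x, T x⟫_ℂ = 0
    · exact ⟨1, by simp, by simp [h0]⟩
    · refine ⟨‖⟪x, T x⟫_ℂ‖ / ⟪x, T x⟫_ℂ, ?_, ?_⟩
      · simp [h0]
      · field_simp
  have hle := hw x hx
  have ha0 : 0 ≤ ‖⟪x, T x⟫_ℂ‖ := norm_nonneg _
  have hxx : ⟪x, x⟫_ℂ = 1 := by simp [inner_self_eq_norm_sq_to_K, hx]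
  generalize ‖⟪x, T x⟫_ℂ‖ = a at *
  set v := w • T x - (a : ℂ) • x with hv
  have hxv : ⟪x, v⟫_ℂ = 0 := by
    simp [hv, inner_sub_right, inner_smul_right, hwa, hx]
  have hTn : ‖T x‖ ^ 2 = a ^ 2 + ‖v‖ ^ 2 := by
    have := norm_add_sq_eq_norm_sq_add_norm_sq_of_inner_eq_zero (𝕜 := ℂ) ((a : ℂ) • x) v
      (by rw [inner_smul_left, hxv, mul_zero])
    rw [show (a : ℂ) • x + v = w • T x by simp [hv], norm_smul, norm_smul, hw1, hx] at this
    simp at this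
    nlinarith
  have hs := Real.sqrt_nonneg (1 - a ^ 2)
  have hss := Real.sq_sqrt (show 0 ≤ 1 - a ^ 2 by nlinarith)
  have hvle : ‖v‖ ≤ 1 + Real.sqrt (1 - a ^ 2) := by
    by_cases h0 : v = 0
    · rw [h0, norm_zero]; linarith
    have hvn : (‖v‖ : ℂ) ≠ 0 := by simpa using h0
    refine core_vec (w • T) ?_ x ((‖v‖⁻¹ : ℂ) • v) hx ?_ ?_ a ‖v‖ ?_
    · intro y
      by_cases hy : y = 0
      · simp [hy]
      have hyn : ‖y‖ ≠ 0 := by simpa using hy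
      have := hw ((‖y‖⁻¹ : ℂ) • y) (by simp [norm_smul, hyn])
      simp [inner_smul_left, inner_smul_right] at this
      simp [inner_smul_right, hw1]
      have hp : 0 < ‖y‖ := norm_pos_iff.2 hy
      field_simp at this
      exact this
    · simp [norm_smul, h0]
    · simp [inner_smul_right, hxv]
    · rw [smul_smul, mul_inv_cancel₀ hvn]; simp [hv]
  rw [hTn]
  nlinarith [norm_nonneg v]

/-- Reformulation of Theorem 3.1: if `w(T) ≤ 1`, `‖x‖ ≤ 1`, and `θ ∈ [0, π/2]` is the
hermitian angle between `x` and `Tx` (i.e. `|⟨Tx,x⟩| = ‖Tx‖‖x‖ cos θ`), then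
`‖Tx‖ ≤ max {2|sin θ|, √2}`. -/
theorem stmt18 {H : Type*} [NormedAddCommGroup H] [InnerProductSpace ℂ H]
    (T : H →L[ℂ] H)
    (hw : ∀ y : H, ‖y‖ = 1 → ‖⟪y, T y⟫_ℂ‖ ≤ 1)
    (x : H) (hx : ‖x‖ ≤ 1)
    (θ : ℝ) (hθ0 : 0 ≤ θ) (hθ1 : θ ≤ Real.pi / 2)
    (hcos : ‖⟪x, T x⟫_ℂ‖ = ‖T x‖ * ‖x‖ * Real.cos θ) :
    ‖T x‖ ≤ max (2 * |Real.sin θ|) (Real.sqrt 2) := by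
  by_cases h0 : x = 0
  · simp [h0]
  have hp : 0 < ‖x‖ := norm_pos_iff.2 h0
  obtain ⟨u, hu1, hxu⟩ : ∃ u : H, ‖u‖ = 1 ∧ x = (‖x‖ : ℂ) • u := by
    refine ⟨(‖x‖⁻¹ : ℂ) • x, by simp [norm_smul, h0], ?_⟩
    rw [smul_smul, mul_inv_cancel₀ (by simpa using h0), one_smul]
  have hTx : ‖T x‖ = ‖x‖ * ‖T u‖ := by
    conv_lhs => rw [hxu]
    simp [norm_smul]
  have hin : ‖⟪x, T x⟫_ℂ‖ = ‖x‖ * (‖x‖ * ‖⟪u, T u⟫_ℂ‖) := by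
    conv_lhs => rw [hxu]
    simp [inner_smul_left, inner_smul_right]
  have ha : ‖⟪u, T u⟫_ℂ‖ = ‖T u‖ * Real.cos θ := by
    rw [hin, hTx] at hcos
    have : ‖x‖ * ‖x‖ ≠ 0 := by positivity
    apply mul_left_cancel₀ this
    linarith
  have hk := core_unit T hw u hu1
  have hle := hw u hu1
  rw [ha] at hk hle
  have hca : 0 ≤ ‖T u‖ * Real.cos θ := ha ▸ norm_nonneg _
  have hTu : ‖T x‖ ≤ ‖T u‖ := by
    rw [hTx]; nlinarith [norm_nonneg (T u)]
  refine hTu.trans ?_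
  rw [le_max_iff]
  by_cases h2 : ‖T u‖ ≤ Real.sqrt 2
  · exact Or.inr h2
  left
  push Not at h2
  have ht2 : 2 < ‖T u‖ ^ 2 := (Real.sqrt_lt' (lt_trans (by positivity) h2)).1 h2
  have hss := Real.sq_sqrt (show 0 ≤ 1 - (‖T u‖ * Real.cos θ) ^ 2 by nlinarith)
  have h3 : (‖T u‖ ^ 2 - 2) ^ 2 ≤ 4 * (1 - (‖T u‖ * Real.cos θ) ^ 2) := by
    rw [← hss]
    nlinarith [Real.sqrt_nonneg (1 - (‖T u‖ * Real.cos θ) ^ 2)]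
  have h4 : ‖T u‖ ^ 2 ≤ 4 * Real.sin θ ^ 2 := by
    have := Real.sin_sq_add_cos_sq θ
    have e : ‖T u‖ ^ 2 * ‖T u‖ ^ 2 ≤ ‖T u‖ ^ 2 * (4 * Real.sin θ ^ 2) := by
      rw [show Real.sin θ ^ 2 = 1 - Real.cos θ ^ 2 by linarith]
      nlinarith
    exact le_of_mul_le_mul_left e (by linarith)
  apply le_of_sq_le_sq _ (by positivity)
  rw [mul_pow, sq_abs]; linarith
end
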